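/- The binary code of length 24 generated by the rows {111111111111111111000000, 111110000000000000111110, 000001111100000000111101, 100001000011110000111100, 011000110000001100110011, 000100001011001000111011, 010000100010100010101111} is a [24,7,10] code, and its automorphism group has order 384. -/

import Mathlib

def theRows : Set (Fin 24 → ZMod 2) :=
  {(![1,1,1,1,1,1,1,1,1,1,1,1,1,1,1,1,1,1,0,0,0,0,0,0] : Fin 24 → ZMod 2),
    (![1,1,1,1,1,0,0,0,0,0,0,0,0,0,0,0,0,0,1,1,1,1,1,0] : Fin 24 → ZMod 2),
    (![0,0,0,0,0,1,1,1,1,1,0,0,0,0,0,0,0,0,1,1,1,1,0,1] : Fin 24 → ZMod 2),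
    (![1,0,0,0,0,1,0,0,0,0,1,1,1,1,0,0,0,0,1,1,1,1,0,0] : Fin 24 → ZMod 2),
    (![0,1,1,0,0,0,1,1,0,0,0,0,0,0,1,1,0,0,1,1,0,0,1,1] : Fin 24 → ZMod 2),
    (![0,0,0,1,0,0,0,0,1,0,1,1,0,0,1,0,0,0,1,1,1,0,1,1] : Fin 24 → ZMod 2),
    (![0,1,0,0,0,0,1,0,0,0,1,0,1,0,0,0,1,0,1,0,1,1,1,1] : Fin 24 → ZMod 2)}

/-- The code generated by the given rows. -/
noncomputable def theCode : Submodule (ZMod 2) (Fin 24 → ZMod 2) :=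
  Submodule.span (ZMod 2) theRows

/-- The rows of the generator matrix. -/
def codeRow : Fin 7 → Fin 24 → ZMod 2 :=
  ![![1,1,1,1,1,1,1,1,1,1,1,1,1,1,1,1,1,1,0,0,0,0,0,0],
    ![1,1,1,1,1,0,0,0,0,0,0,0,0,0,0,0,0,0,1,1,1,1,1,0],
    ![0,0,0,0,0,1,1,1,1,1,0,0,0,0,0,0,0,0,1,1,1,1,0,1],
    ![1,0,0,0,0,1,0,0,0,0,1,1,1,1,0,0,0,0,1,1,1,1,0,0],
    ![0,1,1,0,0,0,1,1,0,0,0,0,0,0,1,1,0,0,1,1,0,0,1,1],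
    ![0,0,0,1,0,0,0,0,1,0,1,1,0,0,1,0,0,0,1,1,1,0,1,1],
    ![0,1,0,0,0,0,1,0,0,0,1,0,1,0,0,0,1,0,1,0,1,1,1,1]]

theorem theRows_eq_range : theRows = Set.range codeRow := by
  ext v
  simp only [theRows, codeRow, Set.mem_range, Fin.exists_fin_succ, Set.mem_insert_iff,
    Set.mem_singleton_iff, eq_comm (b := v)]
  simp

theorem mem_theCode_iff {v : Fin 24 → ZMod 2} :
    v ∈ theCode ↔ ∃ c : Fin 7 → ZMod 2, ∑ i, c i • codeRow i = v := by
  rw [theCode, theRows_eq_range, Submodule.mem_span_range_iff_exists_fun]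

theorem le_hammingNorm_sum_codeRow :
    ∀ c : Fin 7 → ZMod 2, c ≠ 0 → 10 ≤ hammingNorm (∑ i, c i • codeRow i) := by
  decide +kernel

theorem linearIndependent_codeRow : LinearIndependent (ZMod 2) codeRow := by
  rw [Fintype.linearIndependent_iff]
  intro c hc
  by_contra! h
  obtain ⟨i, hi⟩ := h
  have := le_hammingNorm_sum_codeRow c fun h0 => hi (congrFun h0 i)
  rw [hc, hammingNorm_zero] at this
  omega

theorem finrank_theCode : Module.finrank (ZMod 2) theCode = 7 := by
  rw [theCode, theRows_eq_range, finrank_span_eq_card linearIndependent_codeRow, Fintype.card_fin]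

/-- The automorphism group of the code, as a permutation group on the coordinates. -/
def codeAut : Subgroup (Equiv.Perm (Fin 24)) where
  carrier := {σ | Submodule.map (LinearMap.funLeft (ZMod 2) (ZMod 2) σ) theCode = theCode}
  one_mem' := Submodule.map_id theCode
  mul_mem' {σ τ} hσ hτ := by
    change Submodule.map (LinearMap.funLeft (ZMod 2) (ZMod 2) (σ ∘ τ)) theCode = theCode
    rw [LinearMap.funLeft_comp, Submodule.map_comp, hσ, hτ]
  inv_mem' {σ} hσ := by
    change Submodule.map (LinearMap.funLeft (ZMod 2) (ZMod 2) ⇑σ⁻¹) theCode = theCode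
    conv_lhs => rw [← (show Submodule.map _ theCode = theCode from hσ)]
    rw [← Submodule.map_comp, ← LinearMap.funLeft_comp]
    have : (σ ∘ ⇑σ⁻¹) = id := by ext x; simp
    rw [this]
    exact Submodule.map_id theCode

theorem comp_mem_theCode {σ : Equiv.Perm (Fin 24)} (hσ : σ ∈ codeAut) {f : Fin 24 → ZMod 2}
    (hf : f ∈ theCode) : f ∘ σ ∈ theCode := by
  have h := Submodule.mem_map_of_mem (f := LinearMap.funLeft (ZMod 2) (ZMod 2) σ) hf
  rwa [show Submodule.map _ theCode = theCode from hσ] at h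

/-- The coordinates of the code are the edges of the complete multipartite graph `K(2,2,2,2)` on
`Fin 8`, in which `v` and `v + 4` are not adjacent; `endpoints j` is the `j`-th edge. -/
def endpoints : Fin 24 → Fin 8 × Fin 8 :=
  ![(1, 4), (1, 3), (1, 7), (1, 2), (1, 6), (4, 5), (3, 5), (5, 7), (2, 5), (5, 6), (2, 3), (2, 7),
    (3, 6), (6, 7), (2, 4), (4, 6), (3, 4), (4, 7), (0, 7), (0, 3), (0, 6), (0, 2), (0, 5), (0, 1)]

/-- The indicator of the edges not containing the vertex `v`. These are the words of weight `18`. -/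
def starWord (v : Fin 8) (j : Fin 24) : ZMod 2 :=
  if (endpoints j).1 = v ∨ (endpoints j).2 = v then 0 else 1

theorem starWord_separates : ∀ j k, (∀ v, starWord v j = starWord v k) → j = k := by
  decide +kernel

theorem starWord_mem (v : Fin 8) : starWord v ∈ theCode := by
  have h : ∀ v, ∃ c : Fin 7 → ZMod 2, ∀ j, ∑ i, c i * codeRow i j = starWord v j := by
    decide +kernel
  obtain ⟨c, hc⟩ := h v
  exact mem_theCode_iff.2 ⟨c, funext fun j => by simpa [Finset.sum_apply] using hc j⟩

theorem theCode_eq_span_starWord : theCode = Submodule.span (ZMod 2) (Set.range starWord) := by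
  have h : ∀ i, ∃ c : Fin 8 → ZMod 2, ∀ j, ∑ v, c v * starWord v j = codeRow i j := by
    decide +kernel
  refine le_antisymm ?_ (Submodule.span_le.2 (Set.range_subset_iff.2 starWord_mem))
  rw [theCode, theRows_eq_range, Submodule.span_le, Set.range_subset_iff]
  intro i
  obtain ⟨c, hc⟩ := h i
  exact (Submodule.mem_span_range_iff_exists_fun _).2
    ⟨c, funext fun j => by simpa [Finset.sum_apply] using hc j⟩

theorem exists_eq_starWord {f : Fin 24 → ZMod 2} (hf : f ∈ theCode) (h : hammingNorm f = 18) :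
    ∃ v, f = starWord v := by
  have key : ∀ c : Fin 7 → ZMod 2, hammingNorm (∑ i, c i • codeRow i) = 18 →
      ∃ v, ∑ i, c i • codeRow i = starWord v := by
    decide +kernel
  obtain ⟨c, rfl⟩ := mem_theCode_iff.1 hf
  exact key c h

theorem hammingNorm_starWord : ∀ v, hammingNorm (starWord v) = 18 := by
  decide +kernel

theorem hammingNorm_starWord_add_eq_ten_iff : ∀ u v,
    hammingNorm (starWord u + starWord v) = 10 ↔ u ≠ v ∧ u ≠ v + 4 := by
  decide +kernel

theorem hammingNorm_starWord_add_eq_twelve_iff : ∀ u v,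
    hammingNorm (starWord u + starWord v) = 12 ↔ u = v + 4 := by
  decide +kernel

theorem hammingNorm_comp_perm {ι R : Type*} [Fintype ι] [DecidableEq R] [Zero R] (f : ι → R)
    (σ : Equiv.Perm ι) : hammingNorm (f ∘ σ) = hammingNorm f :=
  Finset.card_equiv σ fun i => by simp

theorem mem_codeAut_of_starWord {σ : Equiv.Perm (Fin 24)}
    (h : ∀ v, ∃ u, ∀ j, starWord v (σ j) = starWord u j) : σ ∈ codeAut := by
  have hle : Submodule.map (LinearMap.funLeft (ZMod 2) (ZMod 2) σ) theCode ≤ theCode := by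
    rw [Submodule.map_le_iff_le_comap]
    conv_lhs => rw [theCode_eq_span_starWord]
    rw [Submodule.span_le, Set.range_subset_iff]
    intro v
    obtain ⟨u, hu⟩ := h v
    have : LinearMap.funLeft (ZMod 2) (ZMod 2) σ (starWord v) = starWord u := funext hu
    rw [SetLike.mem_coe, Submodule.mem_comap, this]
    exact starWord_mem u
  refine Submodule.eq_of_le_of_finrank_eq hle ?_
  exact LinearEquiv.finrank_map_eq (LinearEquiv.funCongrLeft (ZMod 2) (ZMod 2) σ) theCode

/-- An automorphism of the code induces a map on the vertices. -/
theorem exists_starWord_comp (σ : codeAut) (v : Fin 8) :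
    ∃ u, starWord v ∘ σ.1 = starWord u :=
  exists_eq_starWord (comp_mem_theCode σ.2 (starWord_mem v))
    ((hammingNorm_comp_perm _ _).trans (hammingNorm_starWord v))

theorem card_codeAut_le : Nat.card codeAut ≤ 384 := by
  choose π hπ using exists_starWord_comp
  have hadd (σ : codeAut) (u v : Fin 8) : hammingNorm (starWord (π σ u) + starWord (π σ v)) =
      hammingNorm (starWord u + starWord v) := by
    rw [← hπ, ← hπ, ← hammingNorm_comp_perm (starWord u + starWord v) σ.1]
    rfl
  have hadj (σ : codeAut) (u v : Fin 8) (h : u ≠ v ∧ u ≠ v + 4) :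
      π σ u ≠ π σ v ∧ π σ u ≠ π σ v + 4 := by
    rwa [← hammingNorm_starWord_add_eq_ten_iff, hadd, hammingNorm_starWord_add_eq_ten_iff]
  have hopp (σ : codeAut) (v : Fin 8) : π σ (v + 4) = π σ v + 4 := by
    rw [← hammingNorm_starWord_add_eq_twelve_iff, hadd, hammingNorm_starWord_add_eq_twelve_iff]
  let frames : Finset (Fin 8 × Fin 8 × Fin 8 × Fin 8) := {t |
    (t.1 ≠ t.2.1 ∧ t.1 ≠ t.2.1 + 4) ∧ (t.1 ≠ t.2.2.1 ∧ t.1 ≠ t.2.2.1 + 4) ∧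
    (t.1 ≠ t.2.2.2 ∧ t.1 ≠ t.2.2.2 + 4) ∧ (t.2.1 ≠ t.2.2.1 ∧ t.2.1 ≠ t.2.2.1 + 4) ∧
    (t.2.1 ≠ t.2.2.2 ∧ t.2.1 ≠ t.2.2.2 + 4) ∧ (t.2.2.1 ≠ t.2.2.2 ∧ t.2.2.1 ≠ t.2.2.2 + 4)}
  have hframes : frames.card = 384 := by decide +kernel
  let F : codeAut → frames := fun σ => ⟨(π σ 0, π σ 1, π σ 2, π σ 3), Finset.mem_filter.2
    ⟨Finset.mem_univ _, hadj σ 0 1 (by decide), hadj σ 0 2 (by decide), hadj σ 0 3 (by decide),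
      hadj σ 1 2 (by decide), hadj σ 1 3 (by decide), hadj σ 2 3 (by decide)⟩⟩
  have hF : Function.Injective F := by
    intro σ τ h
    simp only [F, Subtype.mk.injEq, Prod.mk.injEq] at h
    obtain ⟨h0, h1, h2, h3⟩ := h
    have hv : ∀ v, π σ v = π τ v := by
      have hstep (v : Fin 8) (h : π σ v = π τ v) : π σ (v + 4) = π τ (v + 4) := by
        rw [hopp, hopp, h]
      intro v
      fin_cases v
      exacts [h0, h1, h2, h3, hstep 0 h0, hstep 1 h1, hstep 2 h2, hstep 3 h3]
    refine Subtype.ext (Equiv.ext fun j => starWord_separates _ _ fun v => ?_)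
    have h := (hπ σ v).trans ((congrArg starWord (hv v)).trans (hπ τ v).symm)
    exact congrFun h j
  calc Nat.card codeAut ≤ Nat.card frames := Nat.card_le_card_of_injective F hF
    _ = 384 := by rw [Nat.card_eq_fintype_card, Fintype.card_coe, hframes]

/-- An automorphism fixing the coordinate `0`. -/
def stabGenA : Equiv.Perm (Fin 24) where
  toFun := ![0, 1, 2, 4, 3, 5, 6, 7, 9, 8, 12, 13, 10, 11, 15, 14, 16, 17, 18, 19, 21, 20, 22, 23]
  invFun := ![0, 1, 2, 4, 3, 5, 6, 7, 9, 8, 12, 13, 10, 11, 15, 14, 16, 17, 18, 19, 21, 20, 22, 23]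
  left_inv := by decide
  right_inv := by decide

theorem stabGenA_mem : stabGenA ∈ codeAut :=
  mem_codeAut_of_starWord (by decide +kernel)

/-- An automorphism fixing the coordinate `0`. -/
def stabGenB : Equiv.Perm (Fin 24) where
  toFun := ![0, 3, 4, 1, 2, 5, 8, 9, 6, 7, 10, 12, 11, 13, 16, 17, 14, 15, 20, 21, 18, 19, 22, 23]
  invFun := ![0, 3, 4, 1, 2, 5, 8, 9, 6, 7, 10, 12, 11, 13, 16, 17, 14, 15, 20, 21, 18, 19, 22, 23]
  left_inv := by decide
  right_inv := by decide

theorem stabGenB_mem : stabGenB ∈ codeAut :=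
  mem_codeAut_of_starWord (by decide +kernel)

/-- An automorphism fixing the coordinate `0`. -/
def stabGenC : Equiv.Perm (Fin 24) where
  toFun := ![0, 14, 15, 17, 16, 23, 21, 20, 18, 19, 11, 13, 10, 12, 2, 1, 3, 4, 9, 8, 6, 7, 22, 5]
  invFun := ![0, 15, 14, 16, 17, 23, 20, 21, 19, 18, 12, 10, 13, 11, 1, 2, 4, 3, 8, 9, 7, 6, 22, 5]
  left_inv := by decide
  right_inv := by decide

theorem stabGenC_mem : stabGenC ∈ codeAut :=
  mem_codeAut_of_starWord (by decide +kernel)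

/-- An automorphism moving the coordinate `0`. -/
def orbitGenA : Equiv.Perm (Fin 24) where
  toFun := ![1, 3, 4, 0, 23, 6, 8, 9, 5, 22, 14, 15, 21, 20, 16, 19, 10, 12, 13, 11, 18, 17, 7, 2]
  invFun := ![3, 0, 23, 1, 2, 8, 5, 22, 6, 7, 16, 19, 17, 18, 10, 11, 14, 21, 20, 15, 13, 12, 9, 4]
  left_inv := by decide
  right_inv := by decide

theorem orbitGenA_mem : orbitGenA ∈ codeAut :=
  mem_codeAut_of_starWord (by decide +kernel)

/-- An automorphism moving the coordinate `0`. -/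
def orbitGenB : Equiv.Perm (Fin 24) where
  toFun := ![10, 3, 8, 21, 14, 12, 4, 9, 20, 15, 23, 22, 0, 5, 19, 16, 1, 6, 7, 2, 17, 18, 13, 11]
  invFun := ![12, 16, 19, 1, 6, 13, 17, 18, 2, 7, 0, 23, 5, 22, 4, 9, 15, 20, 21, 14, 8, 3, 11, 10]
  left_inv := by decide
  right_inv := by decide

theorem orbitGenB_mem : orbitGenB ∈ codeAut :=
  mem_codeAut_of_starWord (by decide +kernel)

theorem card_stabilizer_ge : 16 ≤ Nat.card (MulAction.stabilizer codeAut (0 : Fin 24)) := by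
  let F : Fin 2 × Fin 2 × Fin 4 → MulAction.stabilizer codeAut (0 : Fin 24) := fun x =>
    ⟨⟨stabGenA, stabGenA_mem⟩ ^ x.1.1 * ⟨stabGenB, stabGenB_mem⟩ ^ x.2.1.1 *
      ⟨stabGenC, stabGenC_mem⟩ ^ x.2.2.1, by
      have hA : (⟨stabGenA, stabGenA_mem⟩ : codeAut) ∈ MulAction.stabilizer codeAut (0 : Fin 24) :=
        show stabGenA 0 = 0 by decide
      have hB : (⟨stabGenB, stabGenB_mem⟩ : codeAut) ∈ MulAction.stabilizer codeAut (0 : Fin 24) :=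
        show stabGenB 0 = 0 by decide
      have hC : (⟨stabGenC, stabGenC_mem⟩ : codeAut) ∈ MulAction.stabilizer codeAut (0 : Fin 24) :=
        show stabGenC 0 = 0 by decide
      exact mul_mem (mul_mem (pow_mem hA _) (pow_mem hB _)) (pow_mem hC _)⟩
  have hF : Function.Injective F := by
    intro x y h
    have h' : ∀ j, (stabGenA ^ x.1.1 * stabGenB ^ x.2.1.1 * stabGenC ^ x.2.2.1) j =
        (stabGenA ^ y.1.1 * stabGenB ^ y.2.1.1 * stabGenC ^ y.2.2.1) j := fun j =>
      congrArg (fun σ : MulAction.stabilizer codeAut (0 : Fin 24) => (σ : codeAut).1 j) h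
    have : ∀ x y : Fin 2 × Fin 2 × Fin 4,
        (∀ j, (stabGenA ^ x.1.1 * stabGenB ^ x.2.1.1 * stabGenC ^ x.2.2.1) j =
          (stabGenA ^ y.1.1 * stabGenB ^ y.2.1.1 * stabGenC ^ y.2.2.1) j) → x = y := by
      decide +kernel
    exact this x y h'
  simpa using Nat.card_le_card_of_injective F hF

theorem orbit_eq_univ : MulAction.orbit codeAut (0 : Fin 24) = Set.univ := by
  have h : ∀ i, ∃ j : Fin 3, ∃ k : Fin 8, (orbitGenA ^ j.1 * orbitGenB ^ k.1) 0 = i := by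
    decide +kernel
  refine Set.eq_univ_of_forall fun i => ?_
  obtain ⟨j, k, hi⟩ := h i
  exact ⟨⟨_, mul_mem (pow_mem orbitGenA_mem j.1) (pow_mem orbitGenB_mem k.1)⟩, hi⟩

theorem card_codeAut : Nat.card codeAut = 384 := by
  refine le_antisymm card_codeAut_le ?_
  have h := (MulAction.stabilizer codeAut (0 : Fin 24)).card_mul_index
  rw [MulAction.index_stabilizer, orbit_eq_univ, Set.ncard_univ, Nat.card_fin] at h
  have := card_stabilizer_ge
  omega

/-- The given code is a [24,7,10] code and its automorphism group
has order 384. -/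
theorem code_props :
    Module.finrank (ZMod 2) theCode = 7 ∧
    (∀ v ∈ theCode, v ≠ 0 → 10 ≤ hammingNorm v) ∧
    Nat.card {σ : Equiv.Perm (Fin 24) //
        Submodule.map (LinearMap.funLeft (ZMod 2) (ZMod 2) σ) theCode = theCode} = 384 := by
  refine ⟨finrank_theCode, fun v hv hv0 => ?_, card_codeAut⟩
  obtain ⟨c, rfl⟩ := mem_theCode_iff.1 hv
  refine le_hammingNorm_sum_codeRow c ?_
  rintro rfl
  simp at hv0
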